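/- The Kahn–Lovász theorem follows from Brégman's theorem via: for any graph G on vertices v₁,…,v_m with adjacency matrix Adj(G), the number of perfect matchings satisfies |M_perf(G)|² ≤ perm(Adj(G)). -/

import Mathlib

open Finset

namespace PMSq

open Equiv

variable {m : ℕ}

/-- the least element of the cycle of `x` -/
noncomputable def mn (p : Perm (Fin m)) (x : Fin m) : ℕ :=
  sInf {y | ∃ z : Fin m, z.val = y ∧ p.SameCycle x z}

lemma mn_congr {p q : Perm (Fin m)} {x y : Fin m}
    (h : ∀ z, p.SameCycle x z ↔ q.SameCycle y z) : mn p x = mn q y := by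
  simp only [mn, h]

lemma mn_of_same {p : Perm (Fin m)} {x y : Fin m} (h : p.SameCycle x y) : mn p x = mn p y :=
  mn_congr fun _ => ⟨fun h' => h.symm.trans h', fun h' => h.trans h'⟩

lemma same_of_mn {p : Perm (Fin m)} {x y : Fin m} (h : mn p x = mn p y) : p.SameCycle x y := by
  have key : ∀ x, mn p x ∈ {y | ∃ z : Fin m, z.val = y ∧ p.SameCycle x z} := fun x =>
    Nat.sInf_mem ⟨x.val, x, rfl, Perm.SameCycle.refl _ _⟩
  obtain ⟨z, hz, hxz⟩ := key x
  obtain ⟨w, hw, hyw⟩ := key y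
  have : z = w := Fin.ext (by rw [hz, hw, h])
  subst this
  exact hxz.trans hyw.symm

lemma same_mono {p q : Perm (Fin m)} (h : ∀ x, p.SameCycle x (q x)) {x z : Fin m}
    (hz : q.SameCycle x z) : p.SameCycle x z := by
  obtain ⟨n, -, rfl⟩ := hz.exists_pow_eq'
  induction n with
  | zero => exact Perm.SameCycle.refl _ _
  | succ n ih =>
    rw [pow_succ', Perm.mul_apply]
    exact (ih ⟨n, by simp⟩).trans (h _)

/-- fixed point free involution -/
def Inv (a : Perm (Fin m)) : Prop := ∀ x, a (a x) = x ∧ a x ≠ x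

lemma conj_zpow {a b : Perm (Fin m)} (ha : Inv a) (hb : Inv b) (k : ℤ) (x : Fin m) :
    a (((b * a) ^ k) x) = ((b * a) ^ (-k)) (a x) := by
  have haa : a⁻¹ = a := by
    ext x; rw [Perm.inv_eq_iff_eq.2 (ha x).1.symm]
  have hbb : b⁻¹ = b := by
    ext x; rw [Perm.inv_eq_iff_eq.2 (hb x).1.symm]
  have h1 : a * (b * a) * a⁻¹ = (b * a)⁻¹ := by
    rw [mul_inv_rev, haa, hbb]
    ext x; simp [(ha x).1]
  have h2 : a * (b * a) ^ k * a⁻¹ = (b * a) ^ (-k) := by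
    rw [← _root_.conj_zpow, h1, inv_zpow, zpow_neg]
  rw [← h2]; simp

lemma not_same {a b : Perm (Fin m)} (ha : Inv a) (hb : Inv b) (x : Fin m) :
    ¬ (b * a).SameCycle x (a x) := by
  rintro ⟨k, hk⟩
  obtain ⟨j, rfl | rfl⟩ := Int.even_or_odd' k
  · apply (ha (((b * a) ^ j) x)).2
    rw [PMSq.conj_zpow ha hb, ← hk, ← Perm.mul_apply, ← zpow_add]
    congr 2; ring
  · apply (hb (((b * a) ^ (j + 1)) x)).2
    have h : ∀ y, b y = (b * a) (a y) := fun y => by simp [(ha y).1]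
    rw [h, PMSq.conj_zpow ha hb, ← hk, ← Perm.mul_apply, ← Perm.mul_apply, ← zpow_one_add,
      ← zpow_add]
    congr 2; ring

/-- the colouring -/
def col (a b : Perm (Fin m)) (x : Fin m) : Prop := mn (b * a) x < mn (b * a) (a x)

lemma mn_ab {a b : Perm (Fin m)} (ha : Inv a) (x : Fin m) :
    mn (b * a) (a x) = mn (b * a) (b x) :=
  mn_of_same ⟨1, by simp [(ha x).1]⟩

lemma col_a {a b : Perm (Fin m)} (ha : Inv a) (hb : Inv b) (x : Fin m) :
    col a b (a x) ↔ ¬ col a b x := by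
  have : mn (b * a) x ≠ mn (b * a) (a x) := fun h => not_same ha hb x (same_of_mn h)
  unfold col
  rw [(ha x).1]
  omega

lemma col_b {a b : Perm (Fin m)} (ha : Inv a) (hb : Inv b) (x : Fin m) :
    col a b (b x) ↔ ¬ col a b x := by
  have : mn (b * a) x ≠ mn (b * a) (a x) := fun h => not_same ha hb x (same_of_mn h)
  unfold col
  rw [mn_ab ha (b x), (hb x).1, ← mn_ab ha x]
  omega

open Classical in
/-- the permutation attached to a pair of matchings -/
noncomputable def sg (a b : Perm (Fin m)) (ha : Inv a) (hb : Inv b) : Perm (Fin m) where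
  toFun x := if col a b x then a x else b x
  invFun x := if col a b x then b x else a x
  left_inv x := by
    by_cases h : col a b x <;> simp [h, col_a ha hb, col_b ha hb, (ha x).1, (hb x).1]
  right_inv x := by
    by_cases h : col a b x <;> simp [h, col_a ha hb, col_b ha hb, (ha x).1, (hb x).1]

section
variable {a b : Perm (Fin m)} (ha : Inv a) (hb : Inv b)

lemma sg_pos {x : Fin m} (h : col a b x) : sg a b ha hb x = a x := by simp [sg, h]

lemma sg_neg {x : Fin m} (h : ¬ col a b x) : sg a b ha hb x = b x := by simp [sg, h]

lemma sg_sq_pos {x : Fin m} (h : col a b x) : (sg a b ha hb ^ 2) x = (b * a) x := by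
  rw [pow_two, Perm.mul_apply, sg_pos ha hb h, sg_neg ha hb (by simp [col_a ha hb, h])]
  rfl

lemma sg_sq_neg {x : Fin m} (h : ¬ col a b x) : (sg a b ha hb ^ 2) x = a (b x) := by
  rw [pow_two, Perm.mul_apply, sg_neg ha hb h, sg_pos ha hb (by simp [col_b ha hb, h])]

lemma mn_sg (x : Fin m) : mn (sg a b ha hb ^ 2) x = mn (b * a) x := by
  apply mn_congr
  intro z
  constructor <;> refine same_mono ?_
  · intro y
    by_cases h : col a b y
    · rw [sg_sq_pos ha hb h]; exact ⟨1, by simp⟩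
    · rw [sg_sq_neg ha hb h]
      exact Perm.SameCycle.symm ⟨1, by simp [(ha _).1, (hb _).1]⟩
  · intro y
    by_cases h : col a b y
    · rw [← sg_sq_pos ha hb h]; exact ⟨1, by simp⟩
    · refine Perm.SameCycle.symm ⟨1, ?_⟩
      rw [zpow_one, sg_sq_neg ha hb (by simp [col_a ha hb, col_b ha hb, h])]
      simp [(ha _).1, (hb _).1]

lemma col_iff (x : Fin m) : col a b x ↔
    mn (sg a b ha hb ^ 2) x < mn (sg a b ha hb ^ 2) (sg a b ha hb x) := by
  rw [mn_sg, mn_sg]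
  have : mn (b * a) (sg a b ha hb x) = mn (b * a) (a x) := by
    by_cases h : col a b x
    · rw [sg_pos ha hb h]
    · rw [sg_neg ha hb h, mn_ab ha]
  rw [this]; rfl

lemma sg_symm_pos {x : Fin m} (h : col a b x) : (sg a b ha hb).symm x = b x := by simp [sg, h]

lemma sg_symm_neg {x : Fin m} (h : ¬ col a b x) : (sg a b ha hb).symm x = a x := by simp [sg, h]

end

lemma sg_inj {a b a' b' : Perm (Fin m)} (ha : Inv a) (hb : Inv b) (ha' : Inv a') (hb' : Inv b')
    (h : sg a b ha hb = sg a' b' ha' hb') : a = a' ∧ b = b' := by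
  have hc : ∀ x, col a b x ↔ col a' b' x := fun x => by
    rw [col_iff ha hb, col_iff ha' hb', h]
  constructor <;> apply Equiv.ext <;> intro x <;> by_cases hx : col a b x
  · rw [← sg_pos ha hb hx, ← sg_pos ha' hb' ((hc x).1 hx), h]
  · rw [← sg_symm_neg ha hb hx, ← sg_symm_neg ha' hb' (mt (hc x).2 hx), h]
  · rw [← sg_symm_pos ha hb hx, ← sg_symm_pos ha' hb' ((hc x).1 hx), h]
  · rw [← sg_neg ha hb hx, ← sg_neg ha' hb' (mt (hc x).2 hx), h]

lemma exists_perm (G : SimpleGraph (Fin m)) (M : {M : G.Subgraph // M.IsPerfectMatching}) :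
    ∃ a : Perm (Fin m), ∀ x y, a x = y ↔ M.1.Adj x y := by
  have h := SimpleGraph.Subgraph.isPerfectMatching_iff.1 M.2
  choose f hf hu using h
  have hff : ∀ x, f (f x) = x := fun x => (hu (f x) x (hf x).symm).symm
  refine ⟨⟨f, f, hff, hff⟩, fun x y => ⟨?_, fun h => (hu x y h).symm⟩⟩
  rintro rfl
  exact hf x

end PMSq

open PMSq in
/-- Alon–Friedland: the number of perfect matchings of a graph `G` satisfies
`|M_perf(G)|² ≤ perm(Adj(G))`. -/
theorem perfect_matchings_sq_le_permanent (m : ℕ) (G : SimpleGraph (Fin m))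
    [DecidableRel G.Adj] :
    (Nat.card {M : G.Subgraph // M.IsPerfectMatching}) ^ 2 ≤
      ∑ σ : Equiv.Perm (Fin m), ∏ i, (if G.Adj i (σ i) then 1 else 0 : ℕ) := by
  have hR : ∑ σ : Equiv.Perm (Fin m), ∏ i, (if G.Adj i (σ i) then 1 else 0 : ℕ) =
      Nat.card {σ : Equiv.Perm (Fin m) // ∀ i, G.Adj i (σ i)} := by
    rw [Nat.card_eq_fintype_card, Fintype.card_subtype, Finset.card_filter]
    refine Finset.sum_congr rfl fun σ _ => ?_
    rw [Finset.prod_boole]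
    simp
  rw [hR, pow_two, ← Nat.card_prod]
  choose f hf using exists_perm G
  have hadj : ∀ M x, G.Adj x (f M x) := fun M x => ((hf M x _).1 rfl).adj_sub
  have hinv : ∀ M, Inv (f M) := fun M x =>
    ⟨(hf M _ _).2 ((hf M x _).1 rfl).symm, (hadj M x).ne'⟩
  have hinj : ∀ M N, f M = f N → M = N := by
    intro M N h
    apply Subtype.ext
    apply SimpleGraph.Subgraph.ext
    · rw [SimpleGraph.Subgraph.isSpanning_iff.1 M.2.2, SimpleGraph.Subgraph.isSpanning_iff.1 N.2.2]
    · ext x y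
      rw [← hf M, ← hf N, h]
  refine Nat.card_le_card_of_injective
    (fun p => ⟨sg (f p.1) (f p.2) (hinv _) (hinv _), fun i => ?_⟩) ?_
  · by_cases h : col (f p.1) (f p.2) i
    · rw [sg_pos _ _ h]; exact hadj _ _
    · rw [sg_neg _ _ h]; exact hadj _ _
  · rintro ⟨M, N⟩ ⟨M', N'⟩ h
    obtain ⟨h1, h2⟩ := sg_inj (hinv M) (hinv N) (hinv M') (hinv N') (Subtype.ext_iff.1 h)
    exact Prod.ext (hinj _ _ h1) (hinj _ _ h2)
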